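/- arXiv:1904.06920 — 6 statements merged into one kernel-verified Lean document; each statement's English description precedes it below -/
import Mathlib

section
/- For every integer n ≥ 4, the n-MCT matrix belongs to the submonoid of the 2^n × 2^n complex matrices generated by the set of all single-qubit gate embeddings H_i, (Z_{2^k})_i and (Z_{2^k}†)_i (for qubits 1 ≤ i ≤ n and integers k ≥ 1) together with all two-qubit embeddings CNOT_{i,j} (for i ≠ j). In other words, the n-MCT gate is a finite product of Clifford+Z_N gates acting on exactly n qubits, with no ancillary qubits. -/
/-!
Gates are represented as matrices indexed by `Bool` (single qubit, so a 2×2 matrix)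
or by `Fin n → Bool` (n qubits, so a 2^n × 2^n matrix). The basis index `true`
corresponds to the basis state |1⟩ and `false` to |0⟩.
-/

namespace MCT

/-- The Hadamard gate `H = (1/√2)·[[1,1],[1,−1]]`. -/
noncomputable def Hg : Matrix Bool Bool ℂ :=
  fun a b => (1 / (Real.sqrt 2 : ℂ)) * (if a && b then -1 else 1)

/-- The phase gate `Z_N = diag(1, exp(iπ/N))`. -/
noncomputable def Zg (N : ℕ) : Matrix Bool Bool ℂ :=
  fun a b => if a = b then (if a then Complex.exp (Real.pi * Complex.I / N) else 1) else 0

/-- The adjoint phase gate `Z_N† = diag(1, exp(−iπ/N))`. -/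
noncomputable def Zgd (N : ℕ) : Matrix Bool Bool ℂ :=
  fun a b => if a = b then (if a then Complex.exp (-(Real.pi * Complex.I) / N) else 1) else 0

/-- Embedding `G_i = I₂^{⊗(i−1)} ⊗ G ⊗ I₂^{⊗(n−i)}` of a single-qubit gate `G`
on qubit `i` of `n` qubits. -/
noncomputable def embed {n : ℕ} (G : Matrix Bool Bool ℂ) (i : Fin n) :
    Matrix (Fin n → Bool) (Fin n → Bool) ℂ :=
  fun x y => (if ∀ j, j ≠ i → x j = y j then 1 else 0) * G (x i) (y i)

/-- `CNOT_{i,j}`: the permutation matrix mapping the basis state `y` to the state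
with `y j` replaced by `y j ⊕ y i` (control `i`, target `j`). -/
def cnot {n : ℕ} (i j : Fin n) : Matrix (Fin n → Bool) (Fin n → Bool) ℂ :=
  fun x y => if (∀ k, k ≠ j → x k = y k) ∧ x j = xor (y j) (y i) then 1 else 0

/-- The function on basis states realized by the `n`-MCT gate: the last bit is
XORed with the product (conjunction) of the first `n−1` bits. -/
def mctFun (n : ℕ) (y : Fin n → Bool) : Fin n → Bool :=
  fun k => if (k : ℕ) = n - 1 then
      xor (y k) (decide (∀ j : Fin n, (j : ℕ) < n - 1 → y j = true))
    else y k

/-- The `n`-MCT matrix: the permutation matrix mapping basis state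
`|x₁…x_n⟩` to `|x₁…x_{n−1}, x_n ⊕ (x₁⋯x_{n−1})⟩`. -/
def mct (n : ℕ) : Matrix (Fin n → Bool) (Fin n → Bool) ℂ :=
  fun x y => if x = mctFun n y then 1 else 0

/-- The Clifford+`Z_N` generators on `n` qubits: the embeddings `H_i`,
`(Z_{2^k})_i`, `(Z_{2^k}†)_i` for `k ≥ 1`, and `CNOT_{i,j}` for `i ≠ j`. -/
def cliffordZN (n : ℕ) : Set (Matrix (Fin n → Bool) (Fin n → Bool) ℂ) :=
  {M | (∃ i, M = embed Hg i)
     ∨ (∃ (i : Fin n) (k : ℕ), 1 ≤ k ∧ M = embed (Zg (2 ^ k)) i)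
     ∨ (∃ (i : Fin n) (k : ℕ), 1 ≤ k ∧ M = embed (Zgd (2 ^ k)) i)
     ∨ (∃ i j, i ≠ j ∧ M = cnot i j)}

/-- The map on basis states realized by `cnot i j`. -/
def cnotFun {n : ℕ} (i j : Fin n) (y : Fin n → Bool) : Fin n → Bool :=
  Function.update y j (xor (y j) (y i))

lemma cnotFun_cnotFun {n : ℕ} {i j : Fin n} (h : i ≠ j) (y : Fin n → Bool) :
    cnotFun i j (cnotFun i j y) = y := by
  simp [cnotFun, Function.update_of_ne h]

lemma cnot_apply {n : ℕ} (i j : Fin n) (x y : Fin n → Bool) :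
    cnot i j x y = if x = cnotFun i j y then 1 else 0 := by
  have : x = cnotFun i j y ↔ (∀ k, k ≠ j → x k = y k) ∧ x j = xor (y j) (y i) := by
    rw [cnotFun, Function.eq_update_iff, and_comm]
  simp only [cnot, this]

lemma cnot_mul_diagonal_mul_cnot {n : ℕ} {i j : Fin n} (h : i ≠ j) (f : (Fin n → Bool) → ℂ) :
    cnot i j * Matrix.diagonal f * cnot i j = Matrix.diagonal (f ∘ cnotFun i j) := by
  ext x y
  have hinv := cnotFun_cnotFun h
  rw [Matrix.mul_apply]
  simp only [Matrix.mul_diagonal, cnot_apply, mul_ite, mul_one, mul_zero, Finset.sum_ite_eq',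
    Finset.mem_univ, if_true, hinv, ite_mul, one_mul, zero_mul,
    Matrix.diagonal_apply, Function.comp_apply]
  by_cases hxy : x = y <;> simp [hxy]

lemma embed_mul_apply {n : ℕ} (G : Matrix Bool Bool ℂ) (i : Fin n)
    (M : Matrix (Fin n → Bool) (Fin n → Bool) ℂ) (x y : Fin n → Bool) :
    (embed G i * M) x y = ∑ b, G (x i) b * M (Function.update x i b) y := by
  rw [Matrix.mul_apply]
  symm
  refine Fintype.sum_of_injective (Function.update x i) (Function.update_injective x i) _ _ ?_ ?_
  · intro z hz
    have : ¬ ∀ j, j ≠ i → x j = z j := fun h => hz ⟨z i, by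
      rw [Function.update_eq_iff]; exact ⟨rfl, h⟩⟩
    simp [embed, this]
  · intro b
    have : ∀ j, j ≠ i → x j = Function.update x i b j := fun j hj => by simp [hj]
    rw [embed, if_pos this]
    simp

lemma embed_diagonal {n : ℕ} (c : ℂ) (i : Fin n) :
    embed (fun a b => if a = b then (if a then c else 1) else 0) i =
      Matrix.diagonal fun x => if x i then c else 1 := by
  ext x y
  by_cases hxy : x = y
  · simp [embed, hxy]
  · have : ¬ ((∀ j, j ≠ i → x j = y j) ∧ x i = y i) := fun h => hxy <| funext fun j => by
      by_cases hj : j = i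
      · exact hj ▸ h.2
      · exact h.1 j hj
    rw [Matrix.diagonal_apply_ne _ hxy]
    by_cases h : ∀ j, j ≠ i → x j = y j
    · have hi : x i ≠ y i := fun h' => this ⟨h, h'⟩
      simp [embed, hi]
    · simp [embed, h]

/-- The root of unity `exp(s·iπ/2^k)`. -/
noncomputable def root (s : ℤ) (k : ℕ) : ℂ := Complex.exp (s * (Real.pi * Complex.I) / 2 ^ k)

lemma root_succ_mul_self (s : ℤ) (k : ℕ) : root s (k + 1) * root s (k + 1) = root s k := by
  rw [root, root, ← Complex.exp_add]
  congr 1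
  field_simp
  ring

lemma root_mul_root_neg (s : ℤ) (k : ℕ) : root s k * root (-s) k = 1 := by
  rw [root, root, ← Complex.exp_add, ← Complex.exp_zero]
  congr 1
  push_cast
  ring

/-- The diagonal matrix with phase `c` on the basis states where the qubit `i` and all the qubits
in `T` are set. -/
def controlledPhase {n : ℕ} (T : Finset (Fin n)) (i : Fin n) (c : ℂ) :
    Matrix (Fin n → Bool) (Fin n → Bool) ℂ :=
  Matrix.diagonal fun x => if x i ∧ ∀ j ∈ T, x j then c else 1

lemma controlledPhase_empty_mem {n : ℕ} (i : Fin n) (k : ℕ) (s : ℤ) (hs : s = 1 ∨ s = -1) :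
    controlledPhase ∅ i (root s (k + 1)) ∈ Submonoid.closure (cliffordZN n) := by
  apply Submonoid.subset_closure
  rcases hs with rfl | rfl
  · refine Or.inr (Or.inl ⟨i, k + 1, by omega, ?_⟩)
    have : Zg (2 ^ (k + 1)) =
        fun a b => if a = b then (if a then root 1 (k + 1) else 1) else 0 := by
      ext a b; simp [Zg, root]
    rw [this, embed_diagonal]
    simp [controlledPhase]
  · refine Or.inr (Or.inr (Or.inl ⟨i, k + 1, by omega, ?_⟩))
    have : Zgd (2 ^ (k + 1)) =
        fun a b => if a = b then (if a then root (-1) (k + 1) else 1) else 0 := by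
      ext a b; simp [Zgd, root]
    rw [this, embed_diagonal]
    simp [controlledPhase]

/-- With `A` the conjunction of the qubits in `T`, this is the identity
`2·x_i·x_j·A = x_i·A + x_j·A - (x_i ⊕ x_j)·A` in the exponent. -/
lemma controlledPhase_insert {n : ℕ} {T : Finset (Fin n)} {i j : Fin n} (hi : i ∉ T)
    (hij : j ≠ i) (s : ℤ) (k : ℕ) :
    controlledPhase (insert j T) i (root s k) =
      controlledPhase T i (root s (k + 1)) * controlledPhase T j (root s (k + 1)) *
        (cnot j i * controlledPhase T i (root (-s) (k + 1)) * cnot j i) := by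
  simp only [controlledPhase]
  rw [cnot_mul_diagonal_mul_cnot hij, Matrix.diagonal_mul_diagonal, Matrix.diagonal_mul_diagonal]
  congr 1
  ext x
  have hT : (∀ l ∈ T, cnotFun j i x l) ↔ ∀ l ∈ T, x l :=
    forall₂_congr fun l hl => by
      rw [cnotFun, Function.update_of_ne (ne_of_mem_of_not_mem hl hi)]
  simp only [Function.comp_apply, hT, Finset.forall_mem_insert]
  have hinv := root_mul_root_neg s (k + 1)
  have hsq := root_succ_mul_self s k
  by_cases hA : ∀ l ∈ T, x l = true
  · simp only [eq_true hA, and_true]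
    cases hxi : x i <;> cases hxj : x j <;> simp [cnotFun, hxi, hxj, hinv, hsq]
  · simp [hA]

lemma controlledPhase_mem {n : ℕ} (T : Finset (Fin n)) :
    ∀ (i : Fin n), i ∉ T → ∀ (k : ℕ) (s : ℤ), s = 1 ∨ s = -1 →
      controlledPhase T i (root s k) ∈ Submonoid.closure (cliffordZN n) := by
  induction T using Finset.induction_on with
  | empty =>
    intro i _ k s hs
    have h := controlledPhase_empty_mem i k s hs
    convert mul_mem h h using 1
    simp only [controlledPhase, Matrix.diagonal_mul_diagonal, ← root_succ_mul_self s k]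
    congr 1
    ext x
    split_ifs <;> simp
  | insert j T hj ih =>
    intro i hi k s hs
    rw [Finset.mem_insert, not_or] at hi
    have hji : j ≠ i := Ne.symm hi.1
    have hc : cnot j i ∈ Submonoid.closure (cliffordZN n) :=
      Submonoid.subset_closure (Or.inr (Or.inr (Or.inr ⟨j, i, hji, rfl⟩)))
    rw [controlledPhase_insert hi.2 hji]
    exact mul_mem (mul_mem (ih i hi.2 _ s hs) (ih j hj _ s hs))
      (mul_mem (mul_mem hc (ih i hi.2 _ (-s) (by omega))) hc)

lemma hadamard_conj_controlledPhase {n : ℕ} (t : Fin n) (ht : (t : ℕ) = n - 1) :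
    embed Hg t * controlledPhase (Finset.univ.erase t) t (-1) * embed Hg t = mct n := by
  have hlast : ∀ k : Fin n, (k : ℕ) = n - 1 ↔ k = t := fun k => by rw [Fin.ext_iff, ht]
  have hlt : ∀ k : Fin n, (k : ℕ) < n - 1 ↔ k ≠ t := fun k => by
    rw [Ne, Fin.ext_iff, ht]; omega
  ext x y
  rw [Matrix.mul_assoc, embed_mul_apply]
  have hmct : mct n x y = if (∀ k, k ≠ t → x k = y k) ∧
      x t = xor (y t) (decide (∀ j, j ≠ t → y j = true)) then 1 else 0 := by
    have : x = mctFun n y ↔ (∀ k, k ≠ t → x k = y k) ∧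
        x t = xor (y t) (decide (∀ j, j ≠ t → y j = true)) := by
      have hfun : mctFun n y =
          Function.update y t (xor (y t) (decide (∀ j, j ≠ t → y j = true))) := by
        ext k
        by_cases hk : k = t
        · subst hk; simp [mctFun, hlast, hlt]
        · simp [mctFun, hlast, hk]
      rw [hfun, Function.eq_update_iff, and_comm]
    simp only [mct, this]
  have hoff : ∀ b, (∀ k, k ≠ t → Function.update x t b k = y k) ↔ ∀ k, k ≠ t → x k = y k :=
    fun b => forall₂_congr fun k hk => by rw [Function.update_of_ne hk]
  have hctl : ∀ b, (∀ k, k ≠ t → Function.update x t b k = true) ↔ ∀ k, k ≠ t → x k = true :=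
    fun b => forall₂_congr fun k hk => by rw [Function.update_of_ne hk]
  have hsqrt : ((Real.sqrt 2 : ℝ) : ℂ)⁻¹ * ((Real.sqrt 2 : ℝ) : ℂ)⁻¹ = 1 / 2 := by
    rw [← mul_inv, ← Complex.ofReal_mul, Real.mul_self_sqrt (by norm_num)]
    norm_num
  rw [hmct]
  simp only [controlledPhase, Matrix.diagonal_mul, embed, hoff, Finset.mem_erase,
    Finset.mem_univ, and_true, hctl, Function.update_self, Fintype.sum_bool]
  by_cases hxy : ∀ k, k ≠ t → x k = y k
  · have hA : (∀ k, k ≠ t → x k = true) ↔ ∀ k, k ≠ t → y k = true :=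
      forall₂_congr fun k hk => by rw [hxy k hk]
    by_cases hy : ∀ k, k ≠ t → y k = true
    · simp only [hA, eq_true hxy, eq_true hy]
      cases x t <;> cases y t <;> simp [Hg, hsqrt] <;> norm_num
    · simp only [hA, eq_true hxy, eq_false hy]
      cases x t <;> cases y t <;> simp [Hg, hsqrt] <;> norm_num
  · simp [hxy]

/-- For every `n ≥ 4`, the `n`-MCT gate is a finite product of Clifford+`Z_N`
gates acting on exactly `n` qubits, with no ancillary qubits. -/
theorem mct_mem_closure_cliffordZN :
    ∀ n : ℕ, 4 ≤ n → mct n ∈ Submonoid.closure (cliffordZN n) := by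
  intro n hn
  let t : Fin n := ⟨n - 1, by omega⟩
  let T : Finset (Fin n) := Finset.univ.erase t
  have ht : t ∉ T := Finset.notMem_erase _ _
  have key := controlledPhase_mem T t ht 0 1 (Or.inl rfl)
  have hroot : root 1 0 = -1 := by simp [root]
  rw [hroot] at key
  have hH : embed Hg t ∈ Submonoid.closure (cliffordZN n) :=
    Submonoid.subset_closure (Or.inl ⟨t, rfl⟩)
  rw [← hadamard_conj_controlledPhase t rfl]
  exact mul_mem (mul_mem hH key) hH

end MCT
end

section
/- For every integer n ≥ 4, set m = 2^n − n − 1 and N = 2^{n−1}. There exist matrices C₀ and C₁ on n + m qubits, each lying in the submonoid of 2^{n+m} × 2^{n+m} complex matrices generated by the Clifford gate embeddings H_i, S_i, S_i†, CNOT_{i,j}, and a single phase layer P = D₁ ⊗ ⋯ ⊗ D_{n+m} in which each D_i is either the identity, Z_N, or Z_N†, with exactly 2^n − 1 non-identity factors, such that for every x ∈ {0,1}^n the matrix C₀ · P · C₁ maps the computational basis vector |x⟩ ⊗ |0…0⟩ (ancillas all zero) to (MCT_n |x⟩) ⊗ |0…0⟩; that is, the n-MCT gate can be simulated over Clifford+Z_N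 in unit phase depth with phase count 2^n − 1 using 2^n − n − 1 ancilla lines. -/
/-!
Gates are represented as matrices indexed by `Bool` (single qubit, so a 2×2 matrix)
or by `Fin n → Bool` (n qubits, so a 2^n × 2^n matrix). The basis index `true`
corresponds to the basis state |1⟩ and `false` to |0⟩.
-/

namespace MCT

/-- The Clifford generators on `n` qubits: the embeddings `H_i`, `S_i = (Z₂)_i`,
`S_i† = (Z₂†)_i`, and `CNOT_{i,j}` for `i ≠ j`. -/
def cliffordGens (n : ℕ) : Set (Matrix (Fin n → Bool) (Fin n → Bool) ℂ) :=
  {M | (∃ i, M = embed Hg i)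
     ∨ (∃ i, M = embed (Zg 2) i)
     ∨ (∃ i, M = embed (Zgd 2) i)
     ∨ (∃ i j, i ≠ j ∧ M = cnot i j)}

/-- The phase layer `D₁ ⊗ ⋯ ⊗ D_n` where `D_i = diag(1, e i)`. -/
def phaseLayer {n : ℕ} (e : Fin n → ℂ) : Matrix (Fin n → Bool) (Fin n → Bool) ℂ :=
  fun x y => if x = y then ∏ i, (if x i then e i else 1) else 0

/-- `z` is a valid phase-layer factor: `diag(1, z)` equals the identity, a `Z_{2^k}`
gate, or an adjoint thereof, i.e. `z = exp(iπ m / 2^k)` for some integers `m`, `k ≥ 0`. -/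
def validFactor (z : ℂ) : Prop :=
  ∃ (m : ℤ) (k : ℕ), z = Complex.exp (Real.pi * Complex.I * m / 2 ^ k)

/-- Padding of an `n`-qubit basis state with `m` ancilla qubits in state `|0⟩`. -/
def pad {n m : ℕ} (x : Fin n → Bool) : Fin (n + m) → Bool :=
  fun j => if h : (j : ℕ) < n then x ⟨j, h⟩ else false

/-- The computational basis vector corresponding to the basis state `b`. -/
def basisVec {q : ℕ} (b : Fin q → Bool) : (Fin q → Bool) → ℂ :=
  fun z => if z = b then 1 else 0

/-- The matrix sending the basis state `y` to `f y`. -/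
def funMatrix {q : ℕ} (f : (Fin q → Bool) → Fin q → Bool) :
    Matrix (Fin q → Bool) (Fin q → Bool) ℂ :=
  fun x y => if x = f y then 1 else 0

/-- The parity of the bits of `y` in positions belonging to `S`. -/
def parity {n : ℕ} (S : Finset (Fin n)) (y : Fin n → Bool) : Bool :=
  decide (Odd (S.filter fun i => y i = true).card)

/-- The map on basis states XORing the data bit `i` into the ancilla bit `k` for
every `(i, k) ∈ T`. -/
def addBits {n m : ℕ} (T : Finset (Fin n × Fin m)) (y : Fin (n + m) → Bool) :
    Fin (n + m) → Bool :=
  Fin.append (fun i => y (Fin.castAdd m i)) fun k =>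
    xor (y (Fin.natAdd n k))
      (decide (Odd (T.filter fun p => p.2 = k ∧ y (Fin.castAdd m p.1) = true).card))

lemma mulVec_basisVec {q : ℕ} (M : Matrix (Fin q → Bool) (Fin q → Bool) ℂ)
    (y : Fin q → Bool) : M.mulVec (basisVec y) = fun x => M x y := by
  ext x
  simp [Matrix.mulVec, dotProduct, basisVec]

lemma funMatrix_mulVec_basisVec {q : ℕ} (f : (Fin q → Bool) → Fin q → Bool)
    (y : Fin q → Bool) : (funMatrix f).mulVec (basisVec y) = basisVec (f y) := by
  rw [mulVec_basisVec]; rfl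

lemma phaseLayer_mulVec_basisVec {q : ℕ} (e : Fin q → ℂ) (y : Fin q → Bool) :
    (phaseLayer e).mulVec (basisVec y) =
      (∏ i, (if y i then e i else 1)) • basisVec y := by
  rw [mulVec_basisVec]
  ext x
  by_cases h : x = y <;> simp [phaseLayer, basisVec, h]

lemma hadamard_mulVec_basisVec {q : ℕ} (i : Fin q) (y : Fin q → Bool) :
    (embed Hg i).mulVec (basisVec y) =
      (1 / (Real.sqrt 2 : ℂ)) • (basisVec (Function.update y i false) +
        (if y i then -1 else 1 : ℂ) • basisVec (Function.update y i true)) := by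
  rw [mulVec_basisVec]
  ext x
  have h (b : Bool) : x = Function.update y i b ↔ (∀ j, j ≠ i → x j = y j) ∧ x i = b := by
    rw [Function.eq_update_iff, and_comm]
  simp only [embed, Hg, basisVec, Pi.smul_apply, Pi.add_apply, smul_eq_mul, h]
  by_cases hx : ∀ j, j ≠ i → x j = y j
  · simp only [if_pos hx, and_iff_right hx]
    cases x i <;> cases y i <;> simp
  · simp [hx]

lemma funMatrix_mul {q : ℕ} (f g : (Fin q → Bool) → Fin q → Bool) :
    funMatrix f * funMatrix g = funMatrix (f ∘ g) := by
  ext x y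
  simp [Matrix.mul_apply, funMatrix]

lemma cnot_eq_funMatrix {q : ℕ} {i j : Fin q} :
    cnot i j = funMatrix fun y => Function.update y j (xor (y j) (y i)) := by
  ext x y
  simp only [cnot, funMatrix, Function.eq_update_iff]
  congr 1
  rw [and_comm]

lemma addBits_empty {n m : ℕ} : addBits (∅ : Finset (Fin n × Fin m)) = id := by
  ext y k
  refine Fin.addCases (fun i => ?_) (fun k => ?_) k <;> simp [addBits]

lemma addBits_insert {n m : ℕ} {T : Finset (Fin n × Fin m)} {p : Fin n × Fin m}
    (hp : p ∉ T) (y : Fin (n + m) → Bool) :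
    addBits (insert p T) y =
      Function.update (addBits T y) (Fin.natAdd n p.2)
        (xor (addBits T y (Fin.natAdd n p.2)) (addBits T y (Fin.castAdd m p.1))) := by
  ext k
  refine Fin.addCases (fun i => ?_) (fun k => ?_) k
  · have : Fin.castAdd m i ≠ Fin.natAdd n p.2 := by
      simp only [ne_eq, Fin.ext_iff, Fin.val_castAdd, Fin.val_natAdd]; omega
    rw [Function.update_of_ne this]
    simp [addBits]
  · by_cases hk : k = p.2
    · subst hk
      rw [Function.update_self]
      simp only [addBits, Fin.append_left, Fin.append_right, Finset.filter_insert, true_and]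
      by_cases hy : y (Fin.castAdd m p.1) = true
      · rw [if_pos hy, Finset.card_insert_of_notMem (by simp [hp]), hy]
        simp [Nat.odd_add_one, -Nat.not_odd_iff_even]
      · rw [if_neg hy]
        simp [hy]
    · have : Fin.natAdd n k ≠ Fin.natAdd n p.2 := by
        simpa [Fin.ext_iff] using hk
      rw [Function.update_of_ne this]
      simp [addBits, Finset.filter_insert, Ne.symm hk]

lemma addBits_addBits {n m : ℕ} (T : Finset (Fin n × Fin m)) (y : Fin (n + m) → Bool) :
    addBits T (addBits T y) = y := by
  ext k
  refine Fin.addCases (fun i => ?_) (fun k => ?_) k <;> simp [addBits]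

lemma funMatrix_addBits_mem {n m : ℕ} (T : Finset (Fin n × Fin m)) :
    funMatrix (addBits T) ∈ Submonoid.closure (cliffordGens (n + m)) := by
  induction T using Finset.induction_on with
  | empty =>
    convert Submonoid.one_mem _
    ext x y
    simp [funMatrix, addBits_empty, Matrix.one_apply]
  | insert p T hp ih =>
    have h : funMatrix (addBits (insert p T)) =
        cnot (Fin.castAdd m p.1) (Fin.natAdd n p.2) * funMatrix (addBits T) := by
      rw [cnot_eq_funMatrix, funMatrix_mul]
      congr 1
      ext1 y
      exact addBits_insert hp y
    rw [h]
    refine Submonoid.mul_mem _ (Submonoid.subset_closure ?_) ih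
    refine Or.inr (Or.inr (Or.inr ⟨_, _, ?_, rfl⟩))
    simp only [ne_eq, Fin.ext_iff, Fin.val_castAdd, Fin.val_natAdd]; omega

lemma pad_castAdd {n m : ℕ} (x : Fin n → Bool) (i : Fin n) :
    pad (m := m) x (Fin.castAdd m i) = x i := by
  simp [pad]

lemma pad_natAdd {n m : ℕ} (x : Fin n → Bool) (k : Fin m) :
    pad x (Fin.natAdd n k) = false := by
  simp [pad]

lemma update_pad {n m : ℕ} (x : Fin n → Bool) (i : Fin n) (b : Bool) :
    Function.update (pad (m := m) x) (Fin.castAdd m i) b = pad (Function.update x i b) := by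
  ext k
  refine Fin.addCases (fun j => ?_) (fun k => ?_) k
  · simp [Function.update_apply, pad_castAdd]
  · have : Fin.natAdd n k ≠ Fin.castAdd m i := by
      simp only [ne_eq, Fin.ext_iff, Fin.val_castAdd, Fin.val_natAdd]; omega
    simp [Function.update_of_ne this, pad_natAdd]

lemma addBits_pad {n m : ℕ} (σ : Fin (n + m) → Finset (Fin n))
    (hσ : ∀ i, σ (Fin.castAdd m i) = {i}) (x : Fin n → Bool) (k : Fin (n + m)) :
    addBits (Finset.univ.filter fun p : Fin n × Fin m => p.1 ∈ σ (Fin.natAdd n p.2)) (pad x) k =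
      parity (σ k) x := by
  refine Fin.addCases (fun i => ?_) (fun k => ?_) k
  · cases h : x i <;> simp [addBits, parity, hσ, pad_castAdd, Finset.filter_singleton, h]
  · simp only [addBits, Fin.append_right, pad_natAdd, pad_castAdd, Bool.false_xor, parity]
    congr 2
    refine Finset.card_nbij Prod.fst ?_ ?_ ?_
    · rintro ⟨i, j⟩ h
      simp only [Finset.mem_coe, Finset.mem_filter, Finset.mem_univ, true_and] at h ⊢
      obtain ⟨h, rfl, h'⟩ := h
      exact ⟨h, h'⟩
    · rintro ⟨i, j⟩ h ⟨i', j'⟩ h' hi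
      simp only [Finset.mem_coe, Finset.mem_filter, Finset.mem_univ, true_and] at h h' hi
      simp [hi, h.2.1, h'.2.1]
    · rintro i h
      simp only [Finset.mem_coe, Finset.mem_filter] at h
      exact ⟨(i, k), by simpa using h, rfl⟩

/-- There is an enumeration of the nonempty subsets of the data lines by all lines which
assigns its singleton to each data line. -/
lemma exists_subset_enumeration {n m : ℕ} (h : n + m + 1 = 2 ^ n) :
    ∃ g : Fin (n + m) ≃ (Finset.univ.erase ∅ : Finset (Finset (Fin n))),
      ∀ i, (g (Fin.castAdd m i) : Finset (Fin n)) = {i} := by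
  obtain ⟨g, hg⟩ := Finset.exists_equiv_extend_of_card_eq
    (t := (Finset.univ.erase ∅ : Finset (Finset (Fin n))))
    (α := Fin (n + m)) (by simp; omega)
    (s := Finset.univ.image (Fin.castAdd m))
    (f := Fin.append (fun i => {i}) fun _ => ∅)
    (by intro S; simp only [Finset.mem_image]; rintro ⟨_, ⟨i, _, rfl⟩, rfl⟩; simp)
    (by
      intro a ha b hb hab
      simp only [Finset.coe_image, Finset.coe_univ, Set.image_univ, Set.mem_range] at ha hb
      obtain ⟨i, rfl⟩ := ha
      obtain ⟨j, rfl⟩ := hb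
      simpa using hab)
  exact ⟨g, fun i => by rw [hg _ (by simp)]; simp⟩

lemma sum_powerset_prod_sign {n : ℕ} (f : Fin n → ℤ) :
    ∑ S : Finset (Fin n), ∏ i ∈ S, f i = ∏ i, (f i + 1) := by
  rw [Finset.prod_add_one, Finset.powerset_univ]

/-- The Fourier expansion of the conjunction of `n` bits in terms of parities. -/
lemma sum_sign_mul_parity {n : ℕ} (hn : 1 ≤ n) (x : Fin n → Bool) :
    ∑ S ∈ Finset.univ.erase (∅ : Finset (Fin n)),
        (if parity S x then (-1 : ℤ) ^ (S.card + 1) else 0) =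
      if ∀ i, x i = true then 2 ^ (n - 1) else 0 := by
  have h0 : ∑ S ∈ Finset.univ.erase (∅ : Finset (Fin n)),
        (if parity S x then (-1 : ℤ) ^ (S.card + 1) else 0) =
      ∑ S : Finset (Fin n), (if parity S x then (-1 : ℤ) ^ (S.card + 1) else 0) :=
    Finset.sum_erase _ (by simp [parity])
  have h1 (S : Finset (Fin n)) :
      2 * (if parity S x then (-1 : ℤ) ^ (S.card + 1) else 0) =
        ∏ i ∈ S, (if x i then 1 else -1) - ∏ i ∈ S, (-1) := by
    have : ∏ i ∈ S, (if x i then (1 : ℤ) else -1) =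
        (∏ i ∈ S, (-1)) * (-1) ^ (S.filter fun i => x i = true).card := by
      rw [← Finset.prod_const, Finset.prod_filter, ← Finset.prod_mul_distrib]
      exact Finset.prod_congr rfl fun i _ => by split_ifs <;> simp
    rw [this, Finset.prod_const]
    by_cases hS : Odd (S.filter fun i => x i = true).card
    · simp only [parity, hS, decide_true, if_true, hS.neg_one_pow]; ring
    · simp only [parity, hS, decide_false, (Nat.not_odd_iff_even.1 hS).neg_one_pow]; simp
  have h2 : 2 * ∑ S : Finset (Fin n), (if parity S x then (-1 : ℤ) ^ (S.card + 1) else 0) =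
      if ∀ i, x i = true then 2 ^ n else 0 := by
    rw [Finset.mul_sum, Finset.sum_congr rfl fun S _ => h1 S, Finset.sum_sub_distrib,
      sum_powerset_prod_sign, sum_powerset_prod_sign]
    have : n ≠ 0 := by omega
    split_ifs with hx
    · simp [hx, this]
    · push Not at hx
      obtain ⟨i, hi⟩ := hx
      rw [Finset.prod_eq_zero (Finset.mem_univ i) (by simp [hi])]
      simp [this]
  rw [h0]
  obtain ⟨k, rfl⟩ : ∃ k, n = k + 1 := ⟨n - 1, by omega⟩
  split_ifs with hx
  · rw [if_pos hx, pow_succ] at h2; simp only [Nat.add_sub_cancel]; linarith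
  · rw [if_neg hx] at h2; linarith

/-- Parity phases at a primitive angle multiply to the phase of the controlled `Z` gate. -/
lemma prod_parity_phase {n : ℕ} (hn : 1 ≤ n) {w : ℂ} (hw : w ^ 2 ^ (n - 1) = -1)
    (x : Fin n → Bool) :
    ∏ S ∈ Finset.univ.erase (∅ : Finset (Fin n)),
        (if parity S x then w ^ ((-1 : ℤ) ^ (S.card + 1)) else 1) =
      if ∀ i, x i = true then -1 else 1 := by
  have hw0 : w ≠ 0 := by
    rintro rfl
    simp at hw
  have h1 (S : Finset (Fin n)) : (if parity S x then w ^ ((-1 : ℤ) ^ (S.card + 1)) else 1) =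
      w ^ (if parity S x then (-1 : ℤ) ^ (S.card + 1) else 0) := by
    split_ifs <;> simp
  have h2 (s : Finset (Finset (Fin n))) (f : Finset (Fin n) → ℤ) :
      ∏ S ∈ s, w ^ f S = w ^ ∑ S ∈ s, f S := by
    induction s using Finset.induction_on with
    | empty => simp
    | insert a s ha ih => rw [Finset.prod_insert ha, Finset.sum_insert ha, ih, zpow_add₀ hw0]
  rw [Finset.prod_congr rfl fun S _ => h1 S, h2, sum_sign_mul_parity hn]
  split_ifs
  · rw [← hw]; exact_mod_cast zpow_natCast w (2 ^ (n - 1))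
  · simp

/-- Conjugating the controlled `Z` gate by a Hadamard gate on the last line gives `mctFun`. -/
lemma hadamard_conj_controlledZ {n m : ℕ} {l : Fin n} (hl : (l : ℕ) = n - 1)
    (M : Matrix (Fin (n + m) → Bool) (Fin (n + m) → Bool) ℂ)
    (hM : ∀ x : Fin n → Bool, M.mulVec (basisVec (pad x)) =
      (if ∀ i, x i = true then -1 else 1 : ℂ) • basisVec (pad x)) (x : Fin n → Bool) :
    (embed Hg (Fin.castAdd m l)).mulVec
      (M.mulVec ((embed Hg (Fin.castAdd m l)).mulVec (basisVec (pad x)))) =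
      basisVec (pad (mctFun n x)) := by
  have hs : (1 / (Real.sqrt 2 : ℂ)) * (1 / (Real.sqrt 2 : ℂ)) = 1 / 2 := by
    rw [div_mul_div_comm, ← Complex.ofReal_mul, Real.mul_self_sqrt (by norm_num)]
    norm_num
  obtain ⟨A, hA⟩ : ∃ A, decide (∀ j : Fin n, (j : ℕ) < n - 1 → x j = true) = A := ⟨_, rfl⟩
  have hmct : mctFun n x = Function.update x l (xor (x l) A) := by
    subst hA
    ext k
    by_cases hk : k = l
    · subst hk; simp [mctFun, hl]
    · have : (k : ℕ) ≠ n - 1 := fun h => hk (Fin.ext (h.trans hl.symm))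
      simp [mctFun, this, Function.update_of_ne hk]
  have hall (b : Bool) : (∀ i, Function.update x l b i = true) ↔
      b = true ∧ A = true := by
    rw [← hA, decide_eq_true_iff]
    rw [Function.forall_update_iff x (fun _ c => c = true)]
    refine and_congr_right fun _ => forall_congr' fun j => imp_congr_left ?_
    have := j.isLt
    rw [ne_eq, Fin.ext_iff]
    omega
  rw [hmct]
  simp only [hadamard_mulVec_basisVec, Matrix.mulVec_smul, Matrix.mulVec_add, update_pad, hM,
    pad_castAdd, Function.update_self, Function.update_idem, hall]
  ext z
  cases A <;> cases x l <;> simp only [Pi.smul_apply, Pi.add_apply, smul_eq_mul] <;> simp <;>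
    first
    | linear_combination 2 * basisVec (pad (Function.update x l false)) z * hs
    | linear_combination 2 * basisVec (pad (Function.update x l true)) z * hs

/-- For every `n ≥ 4`, with `m = 2^n − n − 1` ancilla lines and `N = 2^{n−1}`, the
`n`-MCT gate can be simulated over Clifford+`Z_N` in unit phase depth with phase
count `2^n − 1`: there are Clifford operators `C₀`, `C₁` on `n + m` qubits and a
single phase layer `P` whose factors are all `I`, `Z_N` or `Z_N†` with exactly
`2^n − 1` non-identity factors, such that `C₀ · P · C₁` maps `|x⟩ ⊗ |0…0⟩` to
`(MCT_n |x⟩) ⊗ |0…0⟩` for every basis state `x`. -/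
theorem mct_cliffordZN_unit_phase_depth :
    ∀ n : ℕ, 4 ≤ n →
      ∃ (C₀ C₁ : Matrix (Fin (n + (2 ^ n - n - 1)) → Bool)
                        (Fin (n + (2 ^ n - n - 1)) → Bool) ℂ)
        (e : Fin (n + (2 ^ n - n - 1)) → ℂ),
        C₀ ∈ Submonoid.closure (cliffordGens (n + (2 ^ n - n - 1))) ∧
        C₁ ∈ Submonoid.closure (cliffordGens (n + (2 ^ n - n - 1))) ∧
        (∀ i, e i = 1 ∨
              e i = Complex.exp (Real.pi * Complex.I / (2 ^ (n - 1) : ℕ)) ∨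
              e i = Complex.exp (-(Real.pi * Complex.I) / (2 ^ (n - 1) : ℕ))) ∧
        Nat.card {i // e i ≠ 1} = 2 ^ n - 1 ∧
        ∀ x : Fin n → Bool,
          (C₀ * phaseLayer e * C₁).mulVec (basisVec (pad x)) =
            basisVec (pad (mctFun n x)) := by
  intro n hn
  have hq : n + (2 ^ n - n - 1) + 1 = 2 ^ n := by
    have := Nat.lt_two_pow_self (n := n)
    omega
  generalize 2 ^ n - n - 1 = m at hq ⊢
  obtain ⟨g, hg⟩ := exists_subset_enumeration hq
  set w : ℂ := Complex.exp (Real.pi * Complex.I / (2 ^ (n - 1) : ℕ)) with hwdef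
  have hw : w ^ 2 ^ (n - 1) = -1 := by
    rw [hwdef, ← Complex.exp_nat_mul, mul_div_cancel₀ _ (by simp), Complex.exp_pi_mul_I]
  have hinv : Complex.exp (-(Real.pi * Complex.I) / (2 ^ (n - 1) : ℕ)) = w⁻¹ := by
    rw [neg_div, Complex.exp_neg]
  have hw1 : w ≠ 1 := by
    intro h
    rw [h, one_pow] at hw
    norm_num at hw
  set e : Fin (n + m) → ℂ := fun k => w ^ ((-1 : ℤ) ^ ((g k : Finset (Fin n)).card + 1))
    with he
  have hval (k) : e k = w ∨ e k = w⁻¹ := by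
    rcases neg_one_pow_eq_or ℤ ((g k : Finset (Fin n)).card + 1) with h | h <;> simp [he, h]
  have hne (k) : e k ≠ 1 := by
    rcases hval k with h | h <;> simp [h, hw1]
  set T : Finset (Fin n × Fin m) :=
    Finset.univ.filter fun p => p.1 ∈ (g (Fin.natAdd n p.2) : Finset (Fin n)) with hT
  set l : Fin n := ⟨n - 1, by omega⟩
  have hH : embed Hg (Fin.castAdd m l) ∈ Submonoid.closure (cliffordGens (n + m)) :=
    Submonoid.subset_closure (Or.inl ⟨_, rfl⟩)
  refine ⟨embed Hg (Fin.castAdd m l) * funMatrix (addBits T),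
    funMatrix (addBits T) * embed Hg (Fin.castAdd m l), e,
    Submonoid.mul_mem _ hH (funMatrix_addBits_mem T),
    Submonoid.mul_mem _ (funMatrix_addBits_mem T) hH,
    fun k => Or.inr (by rw [hinv]; exact hval k), ?_, fun x => ?_⟩
  · rw [Nat.card_congr (Equiv.subtypeUnivEquiv hne), Nat.card_eq_fintype_card, Fintype.card_fin]
    omega
  · have hM (x : Fin n → Bool) :
        (funMatrix (addBits T) * phaseLayer e * funMatrix (addBits T)).mulVec
          (basisVec (pad x)) =
        (if ∀ i, x i = true then -1 else 1 : ℂ) • basisVec (pad x) := by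
      rw [← Matrix.mulVec_mulVec, ← Matrix.mulVec_mulVec, funMatrix_mulVec_basisVec,
        phaseLayer_mulVec_basisVec, Matrix.mulVec_smul, funMatrix_mulVec_basisVec,
        addBits_addBits, ← prod_parity_phase (by omega) hw x,
        ← Finset.prod_coe_sort (Finset.univ.erase ∅),
        ← Equiv.prod_comp g]
      simp only [hT, addBits_pad (fun k => (g k : Finset (Fin n))) hg x, he]
    have := hadamard_conj_controlledZ (l := l) rfl _ hM x
    simpa only [Matrix.mulVec_mulVec, Matrix.mul_assoc] using this

end MCT
end

section
/- For every integer n ≥ 1 and all bits a₁, …, a_n ∈ {0,1} (regarded as integers), 2^{n−1} · (a₁ a₂ ⋯ a_n) = Σ_{∅ ≠ S ⊆ {1,…,n}} (−1)^{|S|+1} · (⊕_{i ∈ S} a_i), where the sum ranges over all nonempty subsets S of {1,…,n} and each XOR term ⊕_{i ∈ S} a_i is regarded as the integer 0 or 1. -/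
namespace MCT

/-- A bit regarded as an integer: `true ↦ 1`, `false ↦ 0`. -/
def bi (b : Bool) : ℤ := if b then 1 else 0

theorem two_mul_sum_bi_emod_two {ι : Type*} (a : ι → Bool) (S : Finset ι) :
    2 * ((∑ i ∈ S, bi (a i)) % 2) = 1 - ∏ i ∈ S, (1 - 2 * bi (a i)) := by
  classical
  induction S using Finset.induction_on with
  | empty => simp
  | insert j S hj ih =>
    rw [Finset.sum_insert hj, Finset.prod_insert hj]
    cases h : a j <;> simp only [bi, Bool.false_eq_true, if_true, if_false] at ih ⊢ <;> omega

/-- Modulo-2 inclusion–exclusion for `n` bits: for `a₁, …, a_n ∈ {0,1}`,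
`2^{n−1} · (a₁ ⋯ a_n) = Σ_{∅ ≠ S ⊆ {1,…,n}} (−1)^{|S|+1} · (⊕_{i∈S} a_i)`,
where each XOR term is the integer `0` or `1` equal to the parity of `Σ_{i∈S} a_i`. -/
theorem pow_two_prod_xor_expansion :
    ∀ n : ℕ, 1 ≤ n → ∀ a : Fin n → Bool,
      (2 : ℤ) ^ (n - 1) * ∏ i, bi (a i) =
        ∑ S ∈ Finset.univ.powerset.filter (fun S : Finset (Fin n) => S ≠ ∅),
          (-1 : ℤ) ^ (S.card + 1) * ((∑ i ∈ S, bi (a i)) % 2) := by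
  intro n hn a
  have hterm (S : Finset (Fin n)) :
      2 * ((-1 : ℤ) ^ (S.card + 1) * ((∑ i ∈ S, bi (a i)) % 2)) =
        ∏ i ∈ S, (2 * bi (a i) - 1) - ∏ i ∈ S, (-1 : ℤ) := by
    have hneg : ∏ i ∈ S, (2 * bi (a i) - 1) =
        (-1) ^ S.card * ∏ i ∈ S, (1 - 2 * bi (a i)) := by
      rw [← Finset.prod_const, ← Finset.prod_mul_distrib]
      exact Finset.prod_congr rfl fun i _ => by ring
    rw [mul_left_comm, two_mul_sum_bi_emod_two, hneg, Finset.prod_const]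
    ring
  have hne : n ≠ 0 := by omega
  rw [Finset.sum_filter_of_ne (by rintro S - h rfl; simp at h)]
  apply mul_left_cancel₀ (two_ne_zero (α := ℤ))
  rw [Finset.mul_sum, Finset.sum_congr rfl fun S _ => hterm S, Finset.sum_sub_distrib,
    ← Finset.prod_add_one, ← Finset.prod_add_one, ← mul_assoc, mul_pow_sub_one hne]
  simp [Finset.prod_mul_distrib, hne]

end MCT
end

section
/- For all a, b, c, d ∈ {0,1}, with ω = exp(iπ/8), the following identity of complex numbers holds: ω^{a+b+c+d} · ω^{−((a⊕b)+(a⊕c)+(a⊕d)+(b⊕c)+(b⊕d)+(c⊕d))} · ω^{(a⊕b⊕c)+(a⊕b⊕d)+(a⊕c⊕d)+(b⊕c⊕d)} · ω^{−(a⊕b⊕c⊕d)} = (−1)^{a·b·c·d}; that is, the product of the fifteen Z₈-phases indexed by the nonempty XOR combinations of a, b, c, d, with signs (−1)^{|S|+1}, equals the 4-controlled-Z phase (−1)^{abcd}. -/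
namespace MCT

/-- The phase `ω = exp(iπ/8)` applied by the `Z₈` gate to the `|1⟩` state. -/
noncomputable def ω : ℂ := Complex.exp (Real.pi * Complex.I / 8)

theorem ω_ne_zero : ω ≠ 0 := Complex.exp_ne_zero _

theorem ω_zpow_eight : ω ^ (8 : ℤ) = -1 := by
  rw [ω, ← Complex.exp_int_mul, ← Complex.exp_pi_mul_I]
  congr 1
  push_cast
  ring

/-- The alternating sum of the XOR combinations of four bits is eight times their product. -/
theorem bi_xor_alternating_sum (a b c d : Bool) :
    bi a + bi b + bi c + bi d
        + -(bi (xor a b) + bi (xor a c) + bi (xor a d)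
            + bi (xor b c) + bi (xor b d) + bi (xor c d))
        + (bi (xor (xor a b) c) + bi (xor (xor a b) d)
            + bi (xor (xor a c) d) + bi (xor (xor b c) d))
        + -bi (xor (xor (xor a b) c) d)
      = 8 * (bi a * bi b * bi c * bi d) := by
  revert a b c d
  decide

/-- For `a, b, c, d ∈ {0,1}`, the product of the fifteen `Z₈`-phases indexed by the
nonempty XOR combinations of `a, b, c, d`, with signs `(−1)^{|S|+1}`, equals the
4-controlled-Z phase `(−1)^{abcd}`. -/
theorem z8_phases_realize_cccz :
    ∀ a b c d : Bool,
      ω ^ (bi a + bi b + bi c + bi d)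
        * ω ^ (-(bi (xor a b) + bi (xor a c) + bi (xor a d)
                  + bi (xor b c) + bi (xor b d) + bi (xor c d)))
        * ω ^ (bi (xor (xor a b) c) + bi (xor (xor a b) d)
                + bi (xor (xor a c) d) + bi (xor (xor b c) d))
        * ω ^ (-bi (xor (xor (xor a b) c) d))
      = (-1 : ℂ) ^ (bi a * bi b * bi c * bi d) := by
  intro a b c d
  rw [← zpow_add₀ ω_ne_zero, ← zpow_add₀ ω_ne_zero, ← zpow_add₀ ω_ne_zero,
    bi_xor_alternating_sum, zpow_mul, ω_zpow_eight]

end MCT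
end

section
/- For every integer n ≥ 1 and all bits a₁, …, a_n ∈ {0,1}, ∏_{∅ ≠ S ⊆ {1,…,n}} exp( (−1)^{|S|+1} · iπ/2^{n−1} · (⊕_{i∈S} a_i) ) = (−1)^{a₁ a₂ ⋯ a_n}; that is, a single layer of Z_{2^{n−1}} and Z_{2^{n−1}}† phases applied to the 2^n − 1 nonempty XOR combinations of the n input bits realizes the n-controlled-Z phase. -/
namespace MCT

/-- Over a nonempty index set, the alternating sum of the subset parities is a multiple of
the product of the bits. -/
theorem sum_powerset_neg_one_pow_mul_parity {ι : Type*} (a : ι → Bool) {s : Finset ι}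
    (hs : s.Nonempty) :
    ∑ S ∈ s.powerset, (-1 : ℤ) ^ (S.card + 1) * ((∑ i ∈ S, bi (a i)) % 2)
      = 2 ^ (s.card - 1) * ∏ i ∈ s, bi (a i) := by
  have hterm : ∀ S : Finset ι, 2 * ((-1 : ℤ) ^ (S.card + 1) * ((∑ i ∈ S, bi (a i)) % 2))
      = (∏ i ∈ S, (2 * bi (a i) - 1)) - (-1) ^ S.card := by
    intro S
    have hneg : ∏ i ∈ S, (2 * bi (a i) - 1)
        = (-1) ^ S.card * ∏ i ∈ S, (1 - 2 * bi (a i)) := by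
      rw [← Finset.prod_const, ← Finset.prod_mul_distrib]
      exact Finset.prod_congr rfl fun i _ => by ring
    rw [hneg, pow_succ]
    linear_combination (-(-1 : ℤ) ^ S.card) * two_mul_sum_bi_emod_two a S
  have hcard : s.card = s.card - 1 + 1 := (Nat.sub_add_cancel hs.card_pos).symm
  have hpow : (2 : ℤ) ^ s.card = 2 * 2 ^ (s.card - 1) := by
    rw [← pow_succ', ← hcard]
  refine mul_left_cancel₀ (two_ne_zero (α := ℤ)) ?_
  rw [Finset.mul_sum, Finset.sum_congr rfl fun S _ => hterm S, Finset.sum_sub_distrib,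
    Finset.sum_powerset_neg_one_pow_card_of_nonempty hs, ← Finset.prod_one_add, ← mul_assoc,
    ← hpow]
  simp [Finset.prod_mul_distrib]

/-- For `n ≥ 1` and bits `a₁, …, a_n ∈ {0,1}`, a single layer of `Z_{2^{n−1}}` and
`Z_{2^{n−1}}†` phases applied to the `2^n − 1` nonempty XOR combinations of the `n`
input bits realizes the `n`-controlled-Z phase:
`∏_{∅ ≠ S} exp((−1)^{|S|+1} · iπ/2^{n−1} · (⊕_{i∈S} a_i)) = (−1)^{a₁⋯a_n}`. -/
theorem phase_layer_realizes_mcz :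
    ∀ n : ℕ, 1 ≤ n → ∀ a : Fin n → Bool,
      (∏ S ∈ Finset.univ.powerset.filter (fun S : Finset (Fin n) => S ≠ ∅),
        Complex.exp ((-1 : ℂ) ^ (S.card + 1) * (Real.pi * Complex.I / 2 ^ (n - 1))
          * (((∑ i ∈ S, bi (a i)) % 2 : ℤ) : ℂ)))
      = (-1 : ℂ) ^ (∏ i, bi (a i)) := by
  intro n hn a
  have hne : (Finset.univ : Finset (Fin n)).Nonempty := ⟨⟨0, hn⟩, Finset.mem_univ _⟩
  have hsum := congrArg (Int.cast : ℤ → ℂ) (sum_powerset_neg_one_pow_mul_parity a hne)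
  rw [Finset.card_univ, Fintype.card_fin, Int.cast_sum, Int.cast_mul, Int.cast_pow,
    Int.cast_ofNat] at hsum
  rw [Finset.prod_filter_of_ne (p := fun S : Finset (Fin n) => S ≠ ∅)
    (by rintro S - h rfl; exact h (by simp)), ← Complex.exp_sum]
  have hexp : (-1 : ℂ) ^ (∏ i, bi (a i))
      = Complex.exp ((∏ i, bi (a i) : ℤ) * (Real.pi * Complex.I)) := by
    rw [Complex.exp_int_mul, Complex.exp_pi_mul_I]
  rw [hexp]
  congr 1
  have htwo : (2 : ℂ) ^ (n - 1) ≠ 0 := pow_ne_zero _ two_ne_zero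
  calc _ = (Real.pi * Complex.I / 2 ^ (n - 1)) * ∑ S ∈ (Finset.univ : Finset (Fin n)).powerset,
        (((-1 : ℤ) ^ (S.card + 1) * ((∑ i ∈ S, bi (a i)) % 2) : ℤ) : ℂ) := by
        rw [Finset.mul_sum]
        refine Finset.sum_congr rfl fun S _ => ?_
        rw [Int.cast_mul, Int.cast_pow, Int.cast_neg, Int.cast_one]
        ring
    _ = _ := by
        rw [hsum]
        field_simp

end MCT
end

section
/- For all integers m ≥ 2 and N ≥ 1, the m-controlled Z_N gate on m + 1 qubits (controls c₁,…,c_m, target t) factors as the time-ordered composition of: (1) the (m−1)-controlled Z_{2N} gate with controls c₁,…,c_{m−1} and target t; (2) the singly-controlled Z_{2N} gate with control c_m and target t; (3) the (m−1)-controlled X gate with controls c₁,…,c_{m−1} and target c_m; (4) the singly-controlled Z_{2N}† gate with control c_m and target t; (5) the (m−1)-controlled X gate with controls c₁,…,c_{m−1} and target c_m. Equivalently, as a matrix identity on 2^{m+1} × 2^{m+1} matrices, C^m(Z_N) = MCX · C¹_{c_m,t}(Z_{2N}†) · MCX · C¹_{c_m,t}(Z_{2N}) · C^{m−1}_{c₁…c_{m−1},t}(Z_{2N}),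 where MCX = C^{m−1}_{c₁…c_{m−1},c_m}(X). -/
/-!
Gates are represented as matrices indexed by `Bool` (single qubit, 2×2) or by
`Fin q → Bool` (`q` qubits, 2^q × 2^q), with `true` the basis state |1⟩.
-/

namespace MCT

/-- The Pauli-X gate `X = [[0,1],[1,0]]`. -/
def Xg : Matrix Bool Bool ℂ :=
  fun a b => if a = b then 0 else 1

/-- The controlled gate `C^k(G)` on `q` qubits with control set `ctrls` and target
qubit `t`: it applies the single-qubit gate `G` to the target qubit of a basis
state when all control bits equal `1`, and acts as the identity otherwise. -/
noncomputable def ctrl {q : ℕ} (ctrls : Finset (Fin q)) (t : Fin q)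
    (G : Matrix Bool Bool ℂ) : Matrix (Fin q → Bool) (Fin q → Bool) ℂ :=
  fun x y =>
    if ∀ j, j ≠ t → x j = y j then
      (if ∀ j ∈ ctrls, y j = true then G (x t) (y t)
       else if x t = y t then 1 else 0)
    else 0

/-- The permutation of basis states underlying a controlled `X` gate. -/
def ctrlFlip {q : ℕ} (S : Finset (Fin q)) (t : Fin q) (x : Fin q → Bool) : Fin q → Bool :=
  if ∀ j ∈ S, x j = true then Function.update x t (!x t) else x

/-- A controlled diagonal gate is diagonal. -/
theorem ctrl_eq_diagonal {q : ℕ} (S : Finset (Fin q)) (t : Fin q) (G : Matrix Bool Bool ℂ)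
    (hG : ∀ a b, a ≠ b → G a b = 0) :
    ctrl S t G =
      Matrix.diagonal (fun x => if ∀ j ∈ S, x j = true then G (x t) (x t) else 1) := by
  ext x y
  by_cases hxy : x = y
  · subst hxy
    simp [ctrl]
  · rw [Matrix.diagonal_apply_ne _ hxy]
    unfold ctrl
    by_cases h : ∀ j, j ≠ t → x j = y j
    · have ht : x t ≠ y t := fun ht => hxy <| funext fun j => by
        by_cases hj : j = t
        · rw [hj, ht]
        · exact h j hj
      simp [ht, hG _ _ ht]
    · rw [if_neg h]

/-- A controlled `X` gate is the permutation matrix of `ctrlFlip`. -/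
theorem ctrl_Xg_apply {q : ℕ} (S : Finset (Fin q)) (t : Fin q) (x y : Fin q → Bool) :
    ctrl S t Xg x y = if x = ctrlFlip S t y then 1 else 0 := by
  have key : ∀ b : Bool, x = Function.update y t b ↔ (∀ j, j ≠ t → x j = y j) ∧ x t = b := by
    intro b
    rw [Function.eq_update_iff, and_comm]
  unfold ctrl ctrlFlip Xg
  by_cases hS : ∀ j ∈ S, y j = true
  · rw [if_pos hS, if_pos hS]
    simp only [key]
    by_cases h : ∀ j, j ≠ t → x j = y j
    · cases hx : x t <;> cases hy : y t <;> simp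
    · simp only [h, false_and, if_false]
  · rw [if_neg hS, if_neg hS]
    have hxy := key (y t)
    rw [Function.update_eq_self] at hxy
    simp only [hxy, ite_and]

theorem ctrlFlip_involutive {q : ℕ} (S : Finset (Fin q)) (t : Fin q) (ht : t ∉ S) :
    Function.Involutive (ctrlFlip S t) := by
  intro x
  by_cases h : ∀ j ∈ S, x j = true
  · have h' : ∀ j ∈ S, Function.update x t (!x t) j = true := fun j hj => by
      rw [Function.update_of_ne (ne_of_mem_of_not_mem hj ht)]
      exact h j hj
    simp only [ctrlFlip, if_pos h, if_pos h']
    simp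
  · simp only [ctrlFlip, if_neg h]

/-- Conjugating a diagonal matrix by a controlled `X` gate permutes its entries. -/
theorem ctrl_Xg_mul_diagonal_mul_ctrl_Xg {q : ℕ} (S : Finset (Fin q)) (t : Fin q) (ht : t ∉ S)
    (d : (Fin q → Bool) → ℂ) :
    ctrl S t Xg * Matrix.diagonal d * ctrl S t Xg =
      Matrix.diagonal (fun x => d (ctrlFlip S t x)) := by
  ext x y
  have hinv := ctrlFlip_involutive S t ht
  simp only [Matrix.mul_apply (M := ctrl S t Xg * Matrix.diagonal d), Matrix.mul_diagonal,
    ctrl_Xg_apply]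
  simp only [mul_ite, mul_one, mul_zero, Finset.sum_ite_eq',
    Finset.mem_univ, if_true, hinv y]
  by_cases hxy : x = y
  · subst hxy
    simp
  · simp [hxy]

theorem Zg_apply_of_ne (N : ℕ) (a b : Bool) (h : a ≠ b) : Zg N a b = 0 := by
  simp [Zg, h]

theorem Zgd_apply_of_ne (N : ℕ) (a b : Bool) (h : a ≠ b) : Zgd N a b = 0 := by
  simp [Zgd, h]

theorem Zgd_mul_Zg_self (N : ℕ) (a : Bool) : Zgd N a a * Zg N a a = 1 := by
  cases a
  · simp [Zg, Zgd]
  · simp [Zg, Zgd, ← Complex.exp_add, neg_div]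

theorem Zg_two_mul_sq (N : ℕ) (a : Bool) : Zg (2 * N) a a * Zg (2 * N) a a = Zg N a a := by
  cases a
  · simp [Zg]
  · simp only [Zg, if_true, ← Complex.exp_add]
    congr 1
    push_cast
    ring

/-- The decomposition of a multi-controlled `Z_N` gate for arbitrary control sets. -/
theorem ctrl_insert_Zg {q : ℕ} (S : Finset (Fin q)) (c t : Fin q) (hc : c ∉ S) (hct : c ≠ t)
    (N : ℕ) :
    ctrl (insert c S) t (Zg N) =
      ctrl S c Xg * ctrl {c} t (Zgd (2 * N)) * ctrl S c Xg * ctrl {c} t (Zg (2 * N))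
        * ctrl S t (Zg (2 * N)) := by
  rw [ctrl_eq_diagonal _ _ _ (Zg_apply_of_ne N), ctrl_eq_diagonal _ _ _ (Zgd_apply_of_ne _),
    ctrl_eq_diagonal _ _ _ (Zg_apply_of_ne _), ctrl_eq_diagonal _ _ _ (Zg_apply_of_ne _),
    ctrl_Xg_mul_diagonal_mul_ctrl_Xg _ _ hc, Matrix.diagonal_mul_diagonal,
    Matrix.diagonal_mul_diagonal]
  congr 1
  funext x
  have h1 := Zgd_mul_Zg_self (2 * N) (x t)
  have h2 := Zg_two_mul_sq N (x t)
  by_cases hS : ∀ j ∈ S, x j = true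
  · cases hxc : x c <;>
      simp [ctrlFlip, hxc, Function.update_of_ne hct.symm, h1, h2, eq_true hS]
  · cases hxc : x c <;> simp [ctrlFlip, if_neg hS, hxc, h1]

/-- For `m ≥ 2` and `N ≥ 1`, on `m+1` qubits (controls `c₁,…,c_m` at positions
`0,…,m−1`, target `t` at position `m`), the `m`-controlled `Z_N` gate factors as
`C^m(Z_N) = MCX · C¹_{c_m,t}(Z_{2N}†) · MCX · C¹_{c_m,t}(Z_{2N}) ·
C^{m−1}_{c₁…c_{m−1},t}(Z_{2N})` where `MCX = C^{m−1}_{c₁…c_{m−1},c_m}(X)`. -/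
theorem mcZ_decomposition :
    ∀ m N : ℕ, 2 ≤ m → 1 ≤ N →
      ∀ hcm : m - 1 < m + 1, ∀ ht : m < m + 1,
        ctrl (Finset.univ.filter (fun j : Fin (m + 1) => (j : ℕ) < m)) ⟨m, ht⟩ (Zg N)
          = ctrl (Finset.univ.filter (fun j : Fin (m + 1) => (j : ℕ) < m - 1)) ⟨m - 1, hcm⟩ Xg
            * ctrl {(⟨m - 1, hcm⟩ : Fin (m + 1))} ⟨m, ht⟩ (Zgd (2 * N))
            * ctrl (Finset.univ.filter (fun j : Fin (m + 1) => (j : ℕ) < m - 1)) ⟨m - 1, hcm⟩ Xg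
            * ctrl {(⟨m - 1, hcm⟩ : Fin (m + 1))} ⟨m, ht⟩ (Zg (2 * N))
            * ctrl (Finset.univ.filter (fun j : Fin (m + 1) => (j : ℕ) < m - 1)) ⟨m, ht⟩ (Zg (2 * N)) := by
  intro m N hm _ hcm ht
  have hins : Finset.univ.filter (fun j : Fin (m + 1) => (j : ℕ) < m) =
      insert ⟨m - 1, hcm⟩ (Finset.univ.filter (fun j : Fin (m + 1) => (j : ℕ) < m - 1)) := by
    ext j
    simp only [Finset.mem_filter, Finset.mem_univ, true_and, Finset.mem_insert, Fin.ext_iff]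
    omega
  rw [hins]
  refine ctrl_insert_Zg _ _ _ (by simp) ?_ N
  simp only [ne_eq, Fin.mk.injEq]
  omega

end MCT
end
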